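/- arXiv:1909.00864 — 6 statements merged into one kernel-verified Lean document; each statement's English description precedes it below -/
import Mathlib

section
/- Let V be a finite vertex set and E a finite set of (ordered representative) branches, i.e. pairs of distinct vertices, of a radial (tree, hence bipartite) network, with a two-coloring c : V → Bool such that every branch joins vertices of different colors. Let w : E → ℝ be branch weights with w e ≥ 0 for all e (w e = −G_{ik} > 0 is the negated line conductance), and let l ≤ u be real numbers (the voltage magnitude bounds). Then the value (u − l)² · ∑_{e ∈ E} w e is the greatest element of the set of values ∑_{e=(i,k) ∈ E} w e · (x i − x k)² taken over all maps x : V → ℝ with l ≤ x i ≤ u for all i; moreover it is attained by the alternating assignment x i = u when c i = true and x i = l when c i = false. -/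
/-- **Theorem 1 (voltage-magnitude-constrained hosting capacity).**
For a radial (bipartite) network with branch set `E`, two-coloring `c` separating the
endpoints of every branch, nonnegative branch weights `w` (negated conductances) and
voltage bounds `l ≤ u`, the value `(u - l)^2 * ∑ w` is the greatest value of
`∑_{(i,k) ∈ E} w (i,k) * (x i - x k)^2` over all `x` with `l ≤ x i ≤ u`; moreover it is
attained by the alternating assignment `x i = u` if `c i` and `x i = l` otherwise. -/
theorem stmt_0 {V : Type*} [Fintype V] (E : Finset (V × V))
    (hE : ∀ e ∈ E, e.1 ≠ e.2)
    (c : V → Bool) (hc : ∀ e ∈ E, c e.1 ≠ c e.2)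
    (w : V × V → ℝ) (hw : ∀ e ∈ E, 0 ≤ w e)
    (l u : ℝ) (hlu : l ≤ u) :
    IsGreatest
      {S : ℝ | ∃ x : V → ℝ, (∀ i, l ≤ x i ∧ x i ≤ u) ∧
        S = ∑ e ∈ E, w e * (x e.1 - x e.2) ^ 2}
      ((u - l) ^ 2 * ∑ e ∈ E, w e) ∧
    (∑ e ∈ E, w e * ((if c e.1 then u else l) - (if c e.2 then u else l)) ^ 2
      = (u - l) ^ 2 * ∑ e ∈ E, w e) := by
  have alternating : ∑ e ∈ E, w e * ((if c e.1 then u else l) - (if c e.2 then u else l)) ^ 2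
      = (u - l) ^ 2 * ∑ e ∈ E, w e := by
    rw [Finset.mul_sum]
    refine Finset.sum_congr rfl fun e he => ?_
    have hne := hc e he
    cases h₁ : c e.1 <;> cases h₂ : c e.2 <;> simp_all <;> ring
  refine ⟨⟨⟨fun i => if c i then u else l, fun i => ?_, alternating.symm⟩, ?_⟩, alternating⟩
  · dsimp only
    split_ifs
    · exact ⟨hlu, le_rfl⟩
    · exact ⟨le_rfl, hlu⟩
  · rintro S ⟨x, hx, rfl⟩
    rw [Finset.mul_sum]
    refine Finset.sum_le_sum fun e he => ?_
    rw [mul_comm]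
    refine mul_le_mul_of_nonneg_right (sq_le_sq' ?_ ?_) (hw e he)
    · linarith [(hx e.1).1, (hx e.2).2]
    · linarith [(hx e.1).2, (hx e.2).1]
end

section
/- Define the per-branch power function g(a,b,t) := a² + b² − 2·a·b·cos t. Let 0 < l ≤ u and let t_max ∈ [0, π] satisfy cos t_max ≤ (u + l)/(2u). Then 2·u²·(1 − cos t_max) is the greatest element of the set { g(a,b,t) : l ≤ a ≤ u, l ≤ b ≤ u, |t| ≤ t_max }, attained at a = b = u and t = t_max. -/
/-- The per-branch power function `g(a,b,t) = a² + b² − 2ab cos t`. -/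
noncomputable def g (a b t : ℝ) : ℝ := a ^ 2 + b ^ 2 - 2 * a * b * Real.cos t

/-- If `2uc ≤ u + l`, then `a² + b² − 2abc` is maximal over `[l, u]²` at `a = b = u`. -/
theorem sq_add_sq_sub_le_of_two_mul_le {l u a b c : ℝ} (hl : 0 < l) (hc : 2 * u * c ≤ u + l)
    (hla : l ≤ a) (hau : a ≤ u) (hlb : l ≤ b) (hbu : b ≤ u) :
    a ^ 2 + b ^ 2 - 2 * a * b * c ≤ 2 * u ^ 2 * (1 - c) := by
  have hac : 2 * a * c ≤ u + b := by
    rcases le_total 0 c with h | h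
    · nlinarith [mul_le_mul_of_nonneg_right hau h]
    · nlinarith [mul_nonpos_of_nonneg_of_nonpos (hl.le.trans hla) h]
  have hb : 0 ≤ (u - b) * (u + b - 2 * a * c) := mul_nonneg (by linarith) (by linarith)
  have ha : 0 ≤ (u - a) * (u + a - 2 * u * c) := mul_nonneg (by linarith) (by linarith)
  linarith

/-- **Theorem 2, first regime.** If `0 < l ≤ u`, `t_max ∈ [0, π]` and
`cos t_max ≤ (u + l)/(2u)`, then `2u²(1 − cos t_max)` is the greatest element of
`{ g(a,b,t) : l ≤ a ≤ u, l ≤ b ≤ u, |t| ≤ t_max }`, attained at `a = b = u`,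
`t = t_max`. -/
theorem stmt_1 (l u tmax : ℝ) (hl : 0 < l) (hlu : l ≤ u)
    (ht0 : 0 ≤ tmax) (htpi : tmax ≤ Real.pi)
    (hcrit : Real.cos tmax ≤ (u + l) / (2 * u)) :
    IsGreatest
      {y : ℝ | ∃ a b t : ℝ, l ≤ a ∧ a ≤ u ∧ l ≤ b ∧ b ≤ u ∧ |t| ≤ tmax ∧
        y = g a b t}
      (2 * u ^ 2 * (1 - Real.cos tmax)) ∧
    g u u tmax = 2 * u ^ 2 * (1 - Real.cos tmax) := by
  have hu : 0 < u := hl.trans_le hlu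
  have hmax : g u u tmax = 2 * u ^ 2 * (1 - Real.cos tmax) := by
    unfold g
    ring
  refine ⟨⟨⟨u, u, tmax, hlu, le_rfl, hlu, le_rfl, (abs_of_nonneg ht0).le, hmax.symm⟩, ?_⟩, hmax⟩
  rintro y ⟨a, b, t, hla, hau, hlb, hbu, ht, rfl⟩
  have hcos : Real.cos tmax ≤ Real.cos t := by
    rw [← Real.cos_abs t]
    exact Real.cos_le_cos_of_nonneg_of_le_pi (abs_nonneg t) htpi ht
  have hc : 2 * u * Real.cos tmax ≤ u + l := by
    rwa [le_div_iff₀' (by positivity)] at hcrit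
  have hab : 0 ≤ 2 * a * b := by
    have := hl.trans_le hla
    have := hl.trans_le hlb
    positivity
  calc g a b t ≤ a ^ 2 + b ^ 2 - 2 * a * b * Real.cos tmax :=
        sub_le_sub_left (mul_le_mul_of_nonneg_left hcos hab) _
    _ ≤ 2 * u ^ 2 * (1 - Real.cos tmax) :=
        sq_add_sq_sub_le_of_two_mul_le hl hc hla hau hlb hbu
end

section
/- Define the per-branch power function g(a,b,t) := a² + b² − 2·a·b·cos t. Let 0 < l ≤ u and let t_max ∈ [0, π] satisfy cos t_max ≥ (u + l)/(2u). Then u² + l² − 2·u·l·cos t_max is the greatest element of the set { g(a,b,t) : l ≤ a ≤ u, l ≤ b ≤ u, |t| ≤ t_max }, attained at a = u, b = l and t = t_max. -/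
/-- On the square `[l, u]²`, the form `a² + b² − 2abc` with `u + l ≤ 2uc` and `c ≤ 1` is largest
at the corner `(u, l)`, among the points with `b ≤ a`. -/
theorem sq_add_sq_sub_le_of_le {l u a b c : ℝ} (hl : 0 < l) (hau : a ≤ u) (hlb : l ≤ b)
    (hba : b ≤ a) (hc : u + l ≤ 2 * u * c) (hc1 : c ≤ 1) :
    a ^ 2 + b ^ 2 - 2 * a * b * c ≤ u ^ 2 + l ^ 2 - 2 * u * l * c := by
  have hbc : b * c ≤ b := mul_le_of_le_one_right (by linarith) hc1
  have h₁ : 0 ≤ (u - a) * (u + a - 2 * (b * c)) := mul_nonneg (by linarith) (by linarith)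
  have h₂ : 0 ≤ (b - l) * (2 * u * c - b - l) := mul_nonneg (by linarith) (by linarith)
  linarith

/-- **Theorem 2, second regime.** If `0 < l ≤ u`, `t_max ∈ [0, π]` and
`cos t_max ≥ (u + l)/(2u)`, then `u² + l² − 2ul cos t_max` is the greatest element of
`{ g(a,b,t) : l ≤ a ≤ u, l ≤ b ≤ u, |t| ≤ t_max }`, attained at `a = u`, `b = l`,
`t = t_max` (the high–low voltage pattern). -/
theorem stmt_2 (l u tmax : ℝ) (hl : 0 < l) (hlu : l ≤ u)
    (ht0 : 0 ≤ tmax) (htpi : tmax ≤ Real.pi)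
    (hcrit : (u + l) / (2 * u) ≤ Real.cos tmax) :
    IsGreatest
      {y : ℝ | ∃ a b t : ℝ, l ≤ a ∧ a ≤ u ∧ l ≤ b ∧ b ≤ u ∧ |t| ≤ tmax ∧
        y = g a b t}
      (u ^ 2 + l ^ 2 - 2 * u * l * Real.cos tmax) ∧
    g u l tmax = u ^ 2 + l ^ 2 - 2 * u * l * Real.cos tmax := by
  have hc : u + l ≤ 2 * u * Real.cos tmax := by
    rw [div_le_iff₀ (by linarith)] at hcrit
    linarith
  have hc1 := Real.cos_le_one tmax
  refine ⟨⟨⟨u, l, tmax, hlu, le_rfl, le_rfl, hlu, (abs_of_nonneg ht0).le, rfl⟩, ?_⟩, rfl⟩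
  rintro _ ⟨a, b, t, hla, hau, hlb, hbu, ht, rfl⟩
  have hcos : Real.cos tmax ≤ Real.cos t := by
    rw [← Real.cos_abs t]
    exact Real.cos_le_cos_of_nonneg_of_le_pi (abs_nonneg t) htpi ht
  have hg : g a b t ≤ a ^ 2 + b ^ 2 - 2 * a * b * Real.cos tmax := by
    have hab : 0 ≤ 2 * a * b := mul_nonneg (by linarith) (by linarith)
    exact sub_le_sub_left (mul_le_mul_of_nonneg_left hcos hab) _
  refine hg.trans ?_
  rcases le_total b a with hba | hab
  · exact sq_add_sq_sub_le_of_le hl hau hlb hba hc hc1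
  · linarith [sq_add_sq_sub_le_of_le hl hbu hla hab hc hc1]
end

section
/- Let V be a finite vertex set, E a finite set of branches (pairs of distinct vertices) of a radial (tree, hence bipartite) network with two-coloring c : V → Bool such that every branch joins vertices of different colors, and w : E → ℝ with w e ≥ 0. Let 0 < l ≤ u and t_max ∈ [0, π] with cos t_max ≤ (u + l)/(2u). Then 2·u²·(1 − cos t_max) · ∑_{e ∈ E} w e is the greatest element of the set of values ∑_{e=(i,k) ∈ E} w e · (V i² + V k² − 2·(V i)·(V k)·cos(θ i − θ k)) over all maps V : V → ℝ and θ : V → ℝ with l ≤ V i ≤ u for all i and |θ i − θ k| ≤ t_max for every branch (i,k) ∈ E; it is attained by V i = u for all i and θ i = 0 on one color class, θ i = t_max on the other. -/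
/-- Below the critical angle cosine, the branch generation is maximal when both endpoint
voltages are at their upper bound. -/
lemma branch_generation_le {l u x y C : ℝ} (hl : 0 < l) (hlx : l ≤ x) (hxu : x ≤ u)
    (hly : l ≤ y) (hyu : y ≤ u) (hC : C ≤ (u + l) / (2 * u)) :
    x ^ 2 + y ^ 2 - 2 * x * y * C ≤ 2 * u ^ 2 * (1 - C) := by
  have hu : 0 < u := by linarith
  have hxy : x * y ≤ u * u := mul_le_mul hxu hyu (by linarith) hu.le
  have hC' : 0 ≤ u + l - C * (2 * u) := sub_nonneg.mpr ((le_div_iff₀ (by linarith)).mp hC)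
  have h₁ : 0 ≤ u * ((u - x) * (x - l)) :=
    mul_nonneg hu.le (mul_nonneg (by linarith) (by linarith))
  have h₂ : 0 ≤ u * ((u - y) * (y - l)) :=
    mul_nonneg hu.le (mul_nonneg (by linarith) (by linarith))
  have h₃ : 0 ≤ (u + l) * ((u - x) * (u - y)) :=
    mul_nonneg (by linarith) (mul_nonneg (by linarith) (by linarith))
  have h₄ : 0 ≤ (u + l - C * (2 * u)) * (u * u - x * y) :=
    mul_nonneg hC' (by linarith)
  have h : 0 ≤ u * (2 * u ^ 2 * (1 - C) - (x ^ 2 + y ^ 2 - 2 * x * y * C)) := by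
    linarith
  exact sub_nonneg.mp (nonneg_of_mul_nonneg_right h hu)

/-- **Aggregated first regime of Theorem 2.** For a radial (bipartite) network with
branch set `E`, two-coloring `c`, nonnegative branch weights `w`, voltage bounds
`0 < l ≤ u`, and per-branch angle bound `t_max ∈ [0, π]` with
`cos t_max ≤ (u + l)/(2u)`, the value `2u²(1 − cos t_max) · ∑ w` is the greatest value of
`∑_{(i,k) ∈ E} w (i,k) · (V i² + V k² − 2 V i V k cos(θ i − θ k))` over all feasible
`(V, θ)`; it is attained by `V i = u` everywhere and `θ i = t_max` on one color class,
`θ i = 0` on the other. -/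
theorem stmt_3 {V : Type*} [Fintype V] (E : Finset (V × V))
    (hE : ∀ e ∈ E, e.1 ≠ e.2)
    (c : V → Bool) (hc : ∀ e ∈ E, c e.1 ≠ c e.2)
    (w : V × V → ℝ) (hw : ∀ e ∈ E, 0 ≤ w e)
    (l u tmax : ℝ) (hl : 0 < l) (hlu : l ≤ u)
    (ht0 : 0 ≤ tmax) (htpi : tmax ≤ Real.pi)
    (hcrit : Real.cos tmax ≤ (u + l) / (2 * u)) :
    IsGreatest
      {S : ℝ | ∃ (Vm θ : V → ℝ),
        (∀ i, l ≤ Vm i ∧ Vm i ≤ u) ∧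
        (∀ e ∈ E, |θ e.1 - θ e.2| ≤ tmax) ∧
        S = ∑ e ∈ E, w e *
          (Vm e.1 ^ 2 + Vm e.2 ^ 2
            - 2 * Vm e.1 * Vm e.2 * Real.cos (θ e.1 - θ e.2))}
      (2 * u ^ 2 * (1 - Real.cos tmax) * ∑ e ∈ E, w e) ∧
    (∑ e ∈ E, w e *
        (u ^ 2 + u ^ 2 - 2 * u * u *
          Real.cos ((if c e.1 then tmax else 0) - (if c e.2 then tmax else 0)))
      = 2 * u ^ 2 * (1 - Real.cos tmax) * ∑ e ∈ E, w e) := by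
  have hcos : ∀ e ∈ E, Real.cos
      ((if c e.1 then tmax else 0) - (if c e.2 then tmax else 0)) = Real.cos tmax := by
    intro e he
    have := hc e he
    cases h₁ : c e.1 <;> cases h₂ : c e.2 <;> simp_all
  have hval : ∑ e ∈ E, w e *
      (u ^ 2 + u ^ 2 - 2 * u * u *
        Real.cos ((if c e.1 then tmax else 0) - (if c e.2 then tmax else 0)))
      = 2 * u ^ 2 * (1 - Real.cos tmax) * ∑ e ∈ E, w e := by
    rw [Finset.mul_sum]
    refine Finset.sum_congr rfl fun e he => ?_
    rw [hcos e he]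
    ring
  refine ⟨⟨⟨fun _ => u, fun i => if c i then tmax else 0, fun _ => ⟨hlu, le_rfl⟩,
    fun e _ => ?_, hval.symm⟩, ?_⟩, hval⟩
  · cases h₁ : c e.1 <;> cases h₂ : c e.2 <;> simp [h₁, h₂, abs_of_nonneg ht0, ht0]
  · rintro _ ⟨Vm, θ, hV, hθ, rfl⟩
    rw [Finset.mul_sum]
    refine Finset.sum_le_sum fun e he => ?_
    rw [mul_comm _ (w e)]
    refine mul_le_mul_of_nonneg_left ?_ (hw e he)
    have hmono : Real.cos tmax ≤ Real.cos (θ e.1 - θ e.2) := by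
      rw [← Real.cos_abs (θ e.1 - θ e.2)]
      exact Real.cos_le_cos_of_nonneg_of_le_pi (abs_nonneg _) htpi (hθ e he)
    have hpos : 0 ≤ 2 * Vm e.1 * Vm e.2 :=
      mul_nonneg (by linarith [(hV e.1).1]) (by linarith [(hV e.2).1])
    calc
      _ ≤ Vm e.1 ^ 2 + Vm e.2 ^ 2 - 2 * Vm e.1 * Vm e.2 * Real.cos tmax :=
        sub_le_sub_left (mul_le_mul_of_nonneg_left hmono hpos) _
      _ ≤ _ := branch_generation_le hl (hV e.1).1 (hV e.1).2 (hV e.2).1 (hV e.2).2 hcrit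
end

section
/- Let V be a finite vertex set, E a finite set of branches (pairs of distinct vertices) of a radial (tree, hence bipartite) network with two-coloring c : V → Bool such that every branch joins vertices of different colors, and w : E → ℝ with w e ≥ 0. Let 0 < l ≤ u and t_max ∈ [0, π] with cos t_max ≥ (u + l)/(2u). Then (u² + l² − 2·u·l·cos t_max) · ∑_{e ∈ E} w e is the greatest element of the set of values ∑_{e=(i,k) ∈ E} w e · (V i² + V k² − 2·(V i)·(V k)·cos(θ i − θ k)) over all maps V : V → ℝ and θ : V → ℝ with l ≤ V i ≤ u for all i and |θ i − θ k| ≤ t_max for every branch (i,k) ∈ E; it is attained by V i = u, θ i = t_max on one color class and V i = l, θ i = 0 on the other. -/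
lemma branch_le_of_le {l u C x y : ℝ} (hl : 0 < l) (hC1 : C ≤ 1) (hC : u + l ≤ 2 * u * C)
    (hly : l ≤ y) (hyx : y ≤ x) (hxu : x ≤ u) :
    x ^ 2 + y ^ 2 - 2 * x * y * C ≤ u ^ 2 + l ^ 2 - 2 * u * l * C := by
  have hchord : 0 ≤ (y - l) * (x - y) := mul_nonneg (by linarith) (by linarith)
  have hlC : l * C ≤ l := mul_le_of_le_one_right hl.le hC1
  rcases le_total (l + x - 2 * x * C) 0 with h | h
  · have h1 : 0 ≤ (y - l) * -(l + x - 2 * x * C) := mul_nonneg (by linarith) (by linarith)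
    have h2 : 0 ≤ (u - x) * (u + x - 2 * (l * C)) := mul_nonneg (by linarith) (by linarith)
    linarith
  · have h1 : 0 ≤ (x - y) * (l + x - 2 * x * C) := mul_nonneg (by linarith) h
    have h2 : 0 ≤ (u - x) * (u + x) * (1 - C) :=
      mul_nonneg (mul_nonneg (by linarith) (by linarith)) (by linarith)
    have h3 : 0 ≤ (u - l) * (2 * u * C - (u + l)) := mul_nonneg (by linarith) (by linarith)
    linarith

lemma branch_le {l u C x y : ℝ} (hl : 0 < l) (hC1 : C ≤ 1) (hC : u + l ≤ 2 * u * C)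
    (hx : l ≤ x ∧ x ≤ u) (hy : l ≤ y ∧ y ≤ u) :
    x ^ 2 + y ^ 2 - 2 * x * y * C ≤ u ^ 2 + l ^ 2 - 2 * u * l * C := by
  rcases le_total y x with h | h
  · exact branch_le_of_le hl hC1 hC hy.1 h hx.2
  · linarith [branch_le_of_le hl hC1 hC hx.1 h hy.2]

/-- **Aggregated second regime of Theorem 2.** For a radial (bipartite) network with
branch set `E`, two-coloring `c`, nonnegative branch weights `w`, voltage bounds
`0 < l ≤ u`, and per-branch angle bound `t_max ∈ [0, π]` with
`cos t_max ≥ (u + l)/(2u)`, the value `(u² + l² − 2ul cos t_max) · ∑ w` is the greatest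
value of `∑_{(i,k) ∈ E} w (i,k) · (V i² + V k² − 2 V i V k cos(θ i − θ k))` over all
feasible `(V, θ)`; it is attained by `V i = u, θ i = t_max` on one color class and
`V i = l, θ i = 0` on the other. -/
theorem stmt_4 {V : Type*} [Fintype V] (E : Finset (V × V))
    (hE : ∀ e ∈ E, e.1 ≠ e.2)
    (c : V → Bool) (hc : ∀ e ∈ E, c e.1 ≠ c e.2)
    (w : V × V → ℝ) (hw : ∀ e ∈ E, 0 ≤ w e)
    (l u tmax : ℝ) (hl : 0 < l) (hlu : l ≤ u)
    (ht0 : 0 ≤ tmax) (htpi : tmax ≤ Real.pi)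
    (hcrit : (u + l) / (2 * u) ≤ Real.cos tmax) :
    IsGreatest
      {S : ℝ | ∃ (Vm θ : V → ℝ),
        (∀ i, l ≤ Vm i ∧ Vm i ≤ u) ∧
        (∀ e ∈ E, |θ e.1 - θ e.2| ≤ tmax) ∧
        S = ∑ e ∈ E, w e *
          (Vm e.1 ^ 2 + Vm e.2 ^ 2
            - 2 * Vm e.1 * Vm e.2 * Real.cos (θ e.1 - θ e.2))}
      ((u ^ 2 + l ^ 2 - 2 * u * l * Real.cos tmax) * ∑ e ∈ E, w e) ∧
    (∑ e ∈ E, w e *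
        ((if c e.1 then u else l) ^ 2 + (if c e.2 then u else l) ^ 2
          - 2 * (if c e.1 then u else l) * (if c e.2 then u else l) *
            Real.cos ((if c e.1 then tmax else 0) - (if c e.2 then tmax else 0)))
      = (u ^ 2 + l ^ 2 - 2 * u * l * Real.cos tmax) * ∑ e ∈ E, w e) := by
  have hu : 0 < 2 * u := by linarith
  have hC : u + l ≤ 2 * u * Real.cos tmax := by
    rw [div_le_iff₀ hu] at hcrit
    linarith
  have hattained : ∑ e ∈ E, w e *
        ((if c e.1 then u else l) ^ 2 + (if c e.2 then u else l) ^ 2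
          - 2 * (if c e.1 then u else l) * (if c e.2 then u else l) *
            Real.cos ((if c e.1 then tmax else 0) - (if c e.2 then tmax else 0)))
      = (u ^ 2 + l ^ 2 - 2 * u * l * Real.cos tmax) * ∑ e ∈ E, w e := by
    rw [Finset.mul_sum]
    refine Finset.sum_congr rfl fun e he => ?_
    have hce := hc e he
    cases h1 : c e.1 <;> cases h2 : c e.2 <;> simp_all <;> ring
  refine ⟨⟨⟨fun i => if c i then u else l, fun i => if c i then tmax else 0, fun i => ?_,
    fun e he => ?_, hattained.symm⟩, ?_⟩, hattained⟩
  · cases h : c i <;> simp [h, hlu]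
  · cases h1 : c e.1 <;> cases h2 : c e.2 <;> simp [h1, h2, ht0, abs_of_nonneg]
  · rintro S ⟨Vm, θ, hV, hθ, rfl⟩
    rw [Finset.mul_sum]
    refine Finset.sum_le_sum fun e he => ?_
    rw [mul_comm _ (w e)]
    refine mul_le_mul_of_nonneg_left ?_ (hw e he)
    have hcos : Real.cos tmax ≤ Real.cos (θ e.1 - θ e.2) := by
      rw [← Real.cos_abs (θ e.1 - θ e.2)]
      exact Real.cos_le_cos_of_nonneg_of_le_pi (abs_nonneg _) htpi (hθ e he)
    have hprod : 0 ≤ 2 * Vm e.1 * Vm e.2 :=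
      mul_nonneg (by linarith [hV e.1]) (by linarith [hV e.2])
    linarith [mul_le_mul_of_nonneg_left hcos hprod,
      branch_le hl (Real.cos_le_one tmax) hC (hV e.1) (hV e.2)]
end

section
/- Define g(a,b,t) := a² + b² − 2·a·b·cos t and let G* := max( 2·u²·(1 − cos t_max), u² + l² − 2·u·l·cos t_max ). Let 0 < l ≤ u, t_max ∈ [0, π], and M ≥ 0 (the per-branch thermal bound). Then min(M, G*) is the greatest element of the set { g(a,b,t) : l ≤ a ≤ u, l ≤ b ≤ u, |t| ≤ t_max, g(a,b,t) ≤ M }. -/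
theorem g_comm (a b t : ℝ) : g a b t = g b a t := by
  unfold g
  ring

theorem g_le_max_endpoints {l u x : ℝ} (b t : ℝ) (hlx : l ≤ x) (hxu : x ≤ u) :
    g x b t ≤ max (g u b t) (g l b t) := by
  unfold g
  rcases le_total 0 (x + u - 2 * b * Real.cos t) with h | h
  · exact le_max_of_le_left (by nlinarith [mul_nonneg (sub_nonneg.2 hxu) h])
  · refine le_max_of_le_right ?_
    have h' : x + l - 2 * b * Real.cos t ≤ 0 := by linarith
    nlinarith [mul_nonneg (sub_nonneg.2 hlx) (neg_nonneg.2 h')]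

theorem g_le_of_abs_le {a b t s : ℝ} (ha : 0 ≤ a) (hb : 0 ≤ b) (hts : |t| ≤ s)
    (hs : s ≤ Real.pi) : g a b t ≤ g a b s := by
  have hcos : Real.cos s ≤ Real.cos t := by
    rw [← Real.cos_abs t]
    exact Real.cos_le_cos_of_nonneg_of_le_pi (abs_nonneg t) hs hts
  unfold g
  nlinarith [mul_le_mul_of_nonneg_left hcos (mul_nonneg ha hb)]

theorem g_self (a t : ℝ) : g a a t = 2 * a ^ 2 * (1 - Real.cos t) := by
  unfold g
  ring

theorem g_le_max_vertices {l u a b t s : ℝ} (hl : 0 ≤ l) (hla : l ≤ a) (hau : a ≤ u)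
    (hlb : l ≤ b) (hbu : b ≤ u) (hts : |t| ≤ s) (hs : s ≤ Real.pi) :
    g a b t ≤ max (g u u s) (g u l s) := by
  have hll : g l l s ≤ g u u s := by
    rw [g_self, g_self]
    have : 0 ≤ 1 - Real.cos s := sub_nonneg.2 (Real.cos_le_one s)
    have : l ≤ u := hla.trans hau
    gcongr
  refine (g_le_of_abs_le (hl.trans hla) (hl.trans hlb) hts hs).trans
    ((g_le_max_endpoints b s hla hau).trans (max_le ?_ ?_))
  · simpa only [g_comm u] using g_le_max_endpoints u s hlb hbu
  · rw [g_comm]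
    refine (g_le_max_endpoints l s hlb hbu).trans (max_le (le_max_right _ _) ?_)
    exact hll.trans (le_max_left _ _)

theorem exists_g_eq {u b s y : ℝ} (hbu : b ≤ u) (hs : 0 ≤ s) (hy : 0 ≤ y)
    (hyg : y ≤ g u b s) : ∃ x t : ℝ, b ≤ x ∧ x ≤ u ∧ |t| ≤ s ∧ g u x t = y := by
  have hcont : ContinuousOn (fun r : ℝ => g u (u + r * (b - u)) (r * s)) (Set.Icc 0 1) := by
    unfold g
    fun_prop
  obtain ⟨r, ⟨hr0, hr1⟩, hr⟩ := intermediate_value_Icc zero_le_one hcont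
    (show y ∈ Set.Icc _ _ from ⟨by simpa [g_self] using hy, by simpa using hyg⟩)
  refine ⟨u + r * (b - u), r * s, by nlinarith, by nlinarith, ?_, hr⟩
  rw [abs_of_nonneg (mul_nonneg hr0 hs)]
  exact mul_le_of_le_one_left hs hr1

/-- **Theorem 3 (thermal limit, branch level).** With `0 < l ≤ u`, `t_max ∈ [0, π]`,
per-branch thermal bound `M ≥ 0`, and the unconstrained optimum
`G* = max(2u²(1 − cos t_max), u² + l² − 2ul cos t_max)`, the value `min(M, G*)` is the
greatest element of `{ g(a,b,t) : l ≤ a ≤ u, l ≤ b ≤ u, |t| ≤ t_max, g(a,b,t) ≤ M }`. -/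
theorem stmt_5 (l u tmax M : ℝ) (hl : 0 < l) (hlu : l ≤ u)
    (ht0 : 0 ≤ tmax) (htpi : tmax ≤ Real.pi) (hM : 0 ≤ M) :
    IsGreatest
      {y : ℝ | ∃ a b t : ℝ, l ≤ a ∧ a ≤ u ∧ l ≤ b ∧ b ≤ u ∧ |t| ≤ tmax ∧
        g a b t ≤ M ∧ y = g a b t}
      (min M (max (2 * u ^ 2 * (1 - Real.cos tmax))
        (u ^ 2 + l ^ 2 - 2 * u * l * Real.cos tmax))) := by
  rw [← g_self, show u ^ 2 + l ^ 2 - 2 * u * l * Real.cos tmax = g u l tmax from rfl]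
  refine ⟨?_, ?_⟩
  · obtain ⟨b, hlb, hbu, hb⟩ : ∃ b, l ≤ b ∧ b ≤ u ∧
        max (g u u tmax) (g u l tmax) = g u b tmax := by
      rcases max_choice (g u u tmax) (g u l tmax) with h | h
      · exact ⟨u, hlu, le_rfl, h⟩
      · exact ⟨l, le_rfl, hlu, h⟩
    have hG : 0 ≤ max (g u u tmax) (g u l tmax) := by
      refine le_max_of_le_left ?_
      rw [g_self]
      exact mul_nonneg (by positivity) (sub_nonneg.2 (Real.cos_le_one _))
    obtain ⟨x, t, hbx, hxu, ht, hx⟩ := exists_g_eq hbu ht0 (le_min hM hG)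
      ((min_le_right _ _).trans hb.le)
    exact ⟨u, x, t, hlu, le_rfl, hlb.trans hbx, hxu, ht,
      hx.le.trans (min_le_left _ _), hx.symm⟩
  · rintro _ ⟨a, b, t, hla, hau, hlb, hbu, ht, hgM, rfl⟩
    exact le_min hgM (g_le_max_vertices hl.le hla hau hlb hbu ht htpi)
end
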